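/- arXiv:1509.01134 — 4 statements merged into one kernel-verified Lean document; each statement's English description precedes it below -/
import Mathlib

section
/- Let α, β, a, b ∈ ℝ and let Ψ : ℝ × ℝ × ℝ → ℂ be a smooth joint solution of the first two reduced AKNS hierarchy equations, i.e. i Ψ_{t₁} + H₁(Ψ) = 0 and Ψ_{t₂} + H₂(Ψ) = 0, where H₁(Ψ) = Ψ_xx + 2|Ψ|²Ψ and H₂(Ψ) = Ψ_xxx + 6|Ψ|²Ψ_x. Then the function ψ̃(x,t) := a·Ψ(ax + 4(α − 3bβ)abt, (α − 6bβ)a²t, −βa³t)·exp(−2ibx − 4i(α − 2βb)b²t) is a solution of the Hirota equation i ψ̃_t + α(ψ̃_xx + 2|ψ̃|²ψ̃) − iβ(ψ̃_xxx + 6|ψ̃|²ψ̃_x) = 0. -/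
open Complex ComplexConjugate

/-- The first AKNS flow operator `H₁(f) = f_xx + 2|f|²f` for a function of `x`. -/
noncomputable def H1 (f : ℝ → ℂ) (x : ℝ) : ℂ :=
  iteratedDeriv 2 f x + 2 * (f x * conj (f x)) * f x

/-- The second AKNS flow operator `H₂(f) = f_xxx + 6|f|²f_x` for a function of `x`. -/
noncomputable def H2 (f : ℝ → ℂ) (x : ℝ) : ℂ :=
  iteratedDeriv 3 f x + 6 * (f x * conj (f x)) * deriv f x

/-- `Ψ (x, t₁, t₂)` is a joint solution of the first two reduced AKNS hierarchy
equations: `i Ψ_{t₁} + H₁(Ψ) = 0` and `Ψ_{t₂} + H₂(Ψ) = 0`. -/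
def IsJointSolution12 (Ψ : ℝ → ℝ → ℝ → ℂ) : Prop :=
  ∀ x t₁ t₂ : ℝ,
    Complex.I * deriv (fun s => Ψ x s t₂) t₁ + H1 (fun y => Ψ y t₁ t₂) x = 0 ∧
    deriv (fun s => Ψ x t₁ s) t₂ + H2 (fun y => Ψ y t₁ t₂) x = 0

/-- `ψ (x, t)` solves the Hirota equation `i ψ_t + α H₁(ψ) − i β H₂(ψ) = 0`. -/
def IsHirotaSolution (α β : ℝ) (ψ : ℝ → ℝ → ℂ) : Prop :=
  ∀ x t : ℝ,
    Complex.I * deriv (fun t' => ψ x t') t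
      + (α : ℂ) * H1 (fun y => ψ y t) x
      - Complex.I * (β : ℂ) * H2 (fun y => ψ y t) x = 0

/-- First derivative of an affinely reparametrised function times an exponential. -/
theorem hasDerivAt_comp_affine_mul_exp {f : ℝ → ℂ} (hf : Differentiable ℝ f)
    (a c : ℝ) (κ d : ℂ) (x : ℝ) :
    HasDerivAt (fun y : ℝ => f (a * y + c) * exp (κ * y + d))
      ((a * deriv f (a * x + c) + κ * f (a * x + c)) * exp (κ * x + d)) x := by
  have haff : HasDerivAt (fun y : ℝ => a * y + c) a x := by
    simpa using ((hasDerivAt_id x).const_mul a).add_const c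
  have hcomp := (hf (a * x + c)).hasDerivAt.scomp x haff
  have hexp : HasDerivAt (fun y : ℝ => exp (κ * y + d)) (exp (κ * x + d) * κ) x := by
    have hlin : HasDerivAt (fun y : ℝ => κ * (y : ℂ) + d) κ x := by
      simpa using (((hasDerivAt_id x).ofReal_comp).const_mul κ).add_const d
    exact hlin.cexp
  refine (hcomp.mul hexp).congr_deriv ?_
  simp only [Function.comp_apply, real_smul]
  ring

/-- Derivatives up to third order of `A f(ax + c) exp(κx + d)`. -/
theorem derivs_comp_affine_mul_exp {f : ℝ → ℂ} (hf : ContDiff ℝ (⊤ : ℕ∞) f)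
    (a c : ℝ) (A κ d : ℂ) (x : ℝ) :
    deriv (fun y : ℝ => A * f (a * y + c) * exp (κ * y + d)) x =
        A * (a * deriv f (a * x + c) + κ * f (a * x + c)) * exp (κ * x + d) ∧
    iteratedDeriv 2 (fun y : ℝ => A * f (a * y + c) * exp (κ * y + d)) x =
        A * (a ^ 2 * iteratedDeriv 2 f (a * x + c) + 2 * κ * a * deriv f (a * x + c)
          + κ ^ 2 * f (a * x + c)) * exp (κ * x + d) ∧
    iteratedDeriv 3 (fun y : ℝ => A * f (a * y + c) * exp (κ * y + d)) x =
        A * (a ^ 3 * iteratedDeriv 3 f (a * x + c)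
          + 3 * κ * a ^ 2 * iteratedDeriv 2 f (a * x + c)
          + 3 * κ ^ 2 * a * deriv f (a * x + c) + κ ^ 3 * f (a * x + c))
          * exp (κ * x + d) := by
  have key : ∀ n y, HasDerivAt
      (fun y : ℝ => iteratedDeriv n f (a * y + c) * exp (κ * y + d))
      ((a * iteratedDeriv (n + 1) f (a * y + c) + κ * iteratedDeriv n f (a * y + c))
        * exp (κ * y + d)) y := by
    intro n y
    rw [iteratedDeriv_succ]
    exact hasDerivAt_comp_affine_mul_exp
      (hf.differentiable_iteratedDeriv n (by exact_mod_cast WithTop.coe_lt_top _)) a c κ d y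
  have h1 : deriv (fun y : ℝ => A * f (a * y + c) * exp (κ * y + d)) = fun y : ℝ =>
      A * (a * iteratedDeriv 1 f (a * y + c) + κ * f (a * y + c)) * exp (κ * y + d) := by
    funext y
    have h := (key 0 y).const_mul A
    simp only [iteratedDeriv_zero, zero_add, ← mul_assoc] at h
    exact h.deriv
  have h2 : iteratedDeriv 2 (fun y : ℝ => A * f (a * y + c) * exp (κ * y + d)) =
      fun y : ℝ => A * (a ^ 2 * iteratedDeriv 2 f (a * y + c)
        + 2 * κ * a * iteratedDeriv 1 f (a * y + c) + κ ^ 2 * f (a * y + c))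
        * exp (κ * y + d) := by
    rw [iteratedDeriv_succ, iteratedDeriv_one, h1]
    funext y
    have h := ((key 1 y).const_mul (A * a)).add ((key 0 y).const_mul (A * κ))
    simp only [iteratedDeriv_zero, zero_add] at h
    refine (HasDerivAt.congr_deriv (h.congr_of_eventuallyEq (.of_forall fun z => ?_)) ?_).deriv
    · simp only [Pi.add_apply]
      ring
    · ring
  have h3 : iteratedDeriv 3 (fun y : ℝ => A * f (a * y + c) * exp (κ * y + d)) x =
      A * (a ^ 3 * iteratedDeriv 3 f (a * x + c)
        + 3 * κ * a ^ 2 * iteratedDeriv 2 f (a * x + c)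
        + 3 * κ ^ 2 * a * iteratedDeriv 1 f (a * x + c) + κ ^ 3 * f (a * x + c))
        * exp (κ * x + d) := by
    rw [iteratedDeriv_succ, h2]
    have h := (((key 2 x).const_mul (A * a ^ 2)).add
      ((key 1 x).const_mul (A * (2 * κ * a)))).add ((key 0 x).const_mul (A * κ ^ 2))
    simp only [iteratedDeriv_zero, zero_add] at h
    refine (HasDerivAt.congr_deriv (h.congr_of_eventuallyEq (.of_forall fun z => ?_)) ?_).deriv
    · simp only [Pi.add_apply]
      ring
    · ring
  rw [h1, h2, h3]
  simp only [iteratedDeriv_one, and_self]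

/-- Chain rule along an affine line, in terms of the three partial derivatives. -/
theorem hasDerivAt_comp_line {Ψ : ℝ → ℝ → ℝ → ℂ} (hΨ : Differentiable ℝ ↿Ψ)
    (x₀ p q r t : ℝ) :
    HasDerivAt (fun s => Ψ (x₀ + p * s) (q * s) (r * s))
      (p * deriv (fun y => Ψ y (q * t) (r * t)) (x₀ + p * t)
        + q * deriv (fun s => Ψ (x₀ + p * t) s (r * t)) (q * t)
        + r * deriv (fun s => Ψ (x₀ + p * t) (q * t) s) (r * t)) t := by
  have hL := (hΨ (x₀ + p * t, q * t, r * t)).hasFDerivAt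
  set L := fderiv ℝ (↿Ψ) (x₀ + p * t, q * t, r * t)
  have e1 : HasDerivAt (fun y => Ψ y (q * t) (r * t)) (L (1, 0, 0)) (x₀ + p * t) :=
    HasFDerivAt.comp_hasDerivAt (f := fun y => (y, q * t, r * t)) _ hL
      ((hasDerivAt_id _).prodMk
      ((hasDerivAt_const _ (q * t)).prodMk (hasDerivAt_const _ (r * t))))
  have e2 : HasDerivAt (fun s => Ψ (x₀ + p * t) s (r * t)) (L (0, 1, 0)) (q * t) :=
    HasFDerivAt.comp_hasDerivAt (f := fun s => (x₀ + p * t, s, r * t)) _ hL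
      ((hasDerivAt_const _ (x₀ + p * t)).prodMk
      ((hasDerivAt_id _).prodMk (hasDerivAt_const _ (r * t))))
  have e3 : HasDerivAt (fun s => Ψ (x₀ + p * t) (q * t) s) (L (0, 0, 1)) (r * t) :=
    HasFDerivAt.comp_hasDerivAt (f := fun s => (x₀ + p * t, q * t, s)) _ hL
      ((hasDerivAt_const _ (x₀ + p * t)).prodMk
      ((hasDerivAt_const _ (q * t)).prodMk (hasDerivAt_id _)))
  have hlin : ∀ m : ℝ, HasDerivAt (fun s : ℝ => m * s) m t := fun m => by
    simpa using (hasDerivAt_id t).const_mul m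
  have e : HasDerivAt (fun s => Ψ (x₀ + p * s) (q * s) (r * s)) (L (p, q, r)) t :=
    HasFDerivAt.comp_hasDerivAt (f := fun s => (x₀ + p * s, q * s, r * s)) _ hL
      (((hlin p).const_add x₀).prodMk ((hlin q).prodMk (hlin r)))
  refine e.congr_deriv ?_
  rw [e1.deriv, e2.deriv, e3.deriv]
  have hv : ((p, q, r) : ℝ × ℝ × ℝ) =
      p • ((1, 0, 0) : ℝ × ℝ × ℝ) + q • ((0, 1, 0) : ℝ × ℝ × ℝ)
        + r • ((0, 0, 1) : ℝ × ℝ × ℝ) := by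
    simp
  rw [hv, map_add, map_add, map_smul, map_smul, map_smul]
  simp only [real_smul]

/-- Galilean–scaling symmetry of the Hirota equation: from a joint solution `Ψ`
of the first two reduced AKNS hierarchy equations, the function
`a Ψ(ax + 4(α−3bβ)abt, (α−6bβ)a²t, −βa³t) exp(−2ibx − 4i(α−2βb)b²t)`
solves the Hirota equation. -/
theorem hirota_galilean_scaling (α β a b : ℝ) (Ψ : ℝ → ℝ → ℝ → ℂ)
    (hΨ : ContDiff ℝ (⊤ : ℕ∞) ↿Ψ) (hsol : IsJointSolution12 Ψ) :
    IsHirotaSolution α β (fun x t =>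
      (a : ℂ) * Ψ (a * x + 4 * (α - 3 * b * β) * a * b * t)
          ((α - 6 * b * β) * a ^ 2 * t) (-β * a ^ 3 * t)
        * Complex.exp (-2 * Complex.I * (b : ℂ) * (x : ℂ)
            - 4 * Complex.I * ((α : ℂ) - 2 * (β : ℂ) * (b : ℂ)) * (b : ℂ) ^ 2 * (t : ℂ))) := by
  intro x t
  set p : ℝ := 4 * (α - 3 * b * β) * a * b with hp
  set q : ℝ := (α - 6 * b * β) * a ^ 2 with hq
  set r : ℝ := -β * a ^ 3 with hr
  set ω : ℂ := -(4 * I * ((α : ℂ) - 2 * (β : ℂ) * (b : ℂ)) * (b : ℂ) ^ 2) with hω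
  set κ : ℂ := -2 * I * (b : ℂ) with hκ
  have hphase : ∀ y s : ℝ, κ * (y : ℂ)
      - 4 * I * ((α : ℂ) - 2 * (β : ℂ) * (b : ℂ)) * (b : ℂ) ^ 2 * (s : ℂ)
      = κ * y + ω * s := fun y s => by rw [hω]; ring
  simp only [hphase]
  have hf : ContDiff ℝ (⊤ : ℕ∞) (fun y => Ψ y (q * t) (r * t)) :=
    hΨ.comp (contDiff_id.prodMk (contDiff_const.prodMk contDiff_const))
  obtain ⟨d1, d2, d3⟩ := derivs_comp_affine_mul_exp hf a (p * t) a κ (ω * t) x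
  have hline := hasDerivAt_comp_line (hΨ.differentiable (by simp)) (a * x) p q r t
  have hexp : HasDerivAt (fun s : ℝ => exp (κ * x + ω * s)) (exp (κ * x + ω * t) * ω) t := by
    have hlin : HasDerivAt (fun s : ℝ => κ * x + ω * (s : ℂ)) ω t := by
      simpa using (((hasDerivAt_id t).ofReal_comp).const_mul ω).const_add (κ * x)
    exact hlin.cexp
  have hdt := ((hline.const_mul (a : ℂ)).mul hexp).deriv
  have hnorm : exp (κ * x + ω * t) * conj (exp (κ * x + ω * t)) = 1 := by
    rw [← exp_conj, ← exp_add, ← exp_zero]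
    congr 1
    have h2 : conj (2 : ℂ) = 2 := map_ofNat _ 2
    have h4 : conj (4 : ℂ) = 4 := map_ofNat _ 4
    simp only [hκ, hω, map_add, map_mul, map_neg, map_sub, map_pow, conj_I, conj_ofReal, h2, h4]
    ring
  obtain ⟨s1, s2⟩ := hsol (a * x + p * t) (q * t) (r * t)
  unfold H1 at s1 ⊢
  unfold H2 at s2 ⊢
  rw [d1, d2, d3]
  erw [hdt]
  simp only [map_mul, conj_ofReal] at s1 s2 ⊢
  clear hline hdt d1 d2 d3
  generalize exp (κ * x + ω * t) = E at *
  generalize deriv (fun s => Ψ (a * x + p * t) s (r * t)) (q * t) = T1 at *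
  generalize deriv (fun s => Ψ (a * x + p * t) (q * t) s) (r * t) = T2 at *
  generalize iteratedDeriv 2 (fun y => Ψ y (q * t) (r * t)) (a * x + p * t) = P2 at *
  generalize iteratedDeriv 3 (fun y => Ψ y (q * t) (r * t)) (a * x + p * t) = P3 at *
  generalize deriv (fun y => Ψ y (q * t) (r * t)) (a * x + p * t) = P1 at *
  generalize Ψ (a * x + p * t) (q * t) (r * t) = P at *
  rw [hp, hq, hr, hω, hκ]
  push_cast
  linear_combination ((α - 6 * b * β) * a ^ 2 * a * E : ℂ) * s1
    + (I * (-β * a ^ 3) * a * E) * s2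
    + (2 * α * a ^ 3 * P ^ 2 * conj P * E
      - 6 * I * β * a ^ 3 * P * conj P * (a * P1 + (-2 * I * b) * P) * E) * hnorm
    + (-12 * I * β * a ^ 2 * b ^ 2 * P1 * E + 8 * I ^ 2 * β * b ^ 3 * a * P * E
      + 6 * β * b * a ^ 3 * (P2 + 2 * P ^ 2 * conj P) * E) * I_sq
end

section
/- Let a, b ∈ ℝ and let Ψ : ℝ × ℝ × ℝ → ℂ be a smooth joint solution of the first two reduced AKNS hierarchy equations, i.e. i Ψ_{t₁} + H₁(Ψ) = 0 and Ψ_{t₂} + H₂(Ψ) = 0, where H₁(Ψ) = Ψ_xx + 2|Ψ|²Ψ and H₂(Ψ) = Ψ_xxx + 6|Ψ|²Ψ_x. Define X := ax + 2a(2b)t₁ + 3a(2b)²t₂, T₁ := a²t₁ + 3(2b)a²t₂, T₂ := a³t₂, and Ψ̃(x,t₁,t₂) := a·Ψ(X, T₁, T₂)·exp(−2ibx − i(2b)²t₁ − i(2b)³t₂). Then Ψ̃ is also a smooth joint solution of the first two reduced AKNS hierarchy equations: i Ψ̃_{t₁} + H₁(Ψ̃) = 0 and Ψ̃_{t₂}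 + H₂(Ψ̃) = 0. -/
/-- Chain rule for a function of three real variables along a curve, in terms of the partial
derivatives. -/
theorem hasDerivAt_comp_curve {Ψ : ℝ → ℝ → ℝ → ℂ} {u v w : ℝ → ℝ} {u' v' w' s : ℝ}
    (hΨ : DifferentiableAt ℝ ↿Ψ (u s, v s, w s)) (hu : HasDerivAt u u' s)
    (hv : HasDerivAt v v' s) (hw : HasDerivAt w w' s) :
    HasDerivAt (fun r => Ψ (u r) (v r) (w r))
      ((u' : ℂ) * deriv (fun y => Ψ y (v s) (w s)) (u s)
        + (v' : ℂ) * deriv (fun y => Ψ (u s) y (w s)) (v s)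
        + (w' : ℂ) * deriv (fun y => Ψ (u s) (v s) y) (w s)) s := by
  have hL := hΨ.hasFDerivAt
  set L := fderiv ℝ ↿Ψ (u s, v s, w s)
  have along {f : ℝ → ℝ × ℝ × ℝ} {f' : ℝ × ℝ × ℝ} {r : ℝ} (hf : HasDerivAt f f' r)
      (hr : f r = (u s, v s, w s)) :
      HasDerivAt (fun y => Ψ (f y).1 (f y).2.1 (f y).2.2) (L f') r := by
    rw [← hr] at hL
    exact hL.comp_hasDerivAt r hf
  have h₁ : HasDerivAt (fun y => Ψ y (v s) (w s)) (L (1, 0, 0)) (u s) :=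
    along ((hasDerivAt_id (u s)).prodMk
      ((hasDerivAt_const (u s) (v s)).prodMk (hasDerivAt_const (u s) (w s)))) rfl
  have h₂ : HasDerivAt (fun y => Ψ (u s) y (w s)) (L (0, 1, 0)) (v s) :=
    along ((hasDerivAt_const (v s) (u s)).prodMk
      ((hasDerivAt_id (v s)).prodMk (hasDerivAt_const (v s) (w s)))) rfl
  have h₃ : HasDerivAt (fun y => Ψ (u s) (v s) y) (L (0, 0, 1)) (w s) :=
    along ((hasDerivAt_const (w s) (u s)).prodMk
      ((hasDerivAt_const (w s) (v s)).prodMk (hasDerivAt_id (w s)))) rfl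
  have h : HasDerivAt (fun r => Ψ (u r) (v r) (w r)) (L (u', v', w')) s :=
    along (hu.prodMk (hv.prodMk hw)) rfl
  have hsum : ((u', v', w') : ℝ × ℝ × ℝ)
      = u' • (1, 0, 0) + v' • (0, 1, 0) + w' • (0, 0, 1) := by
    simp
  rw [h₁.deriv, h₂.deriv, h₃.deriv]
  convert h using 1
  rw [hsum, map_add, map_add, map_smul, map_smul, map_smul]
  simp only [Complex.real_smul]

/-- Derivative of the product of an affine reparametrization and an exponential. -/
theorem deriv_comp_affine_mul_exp {g : ℝ → ℂ} (hg : Differentiable ℝ g) (a c : ℝ) (k d : ℂ) :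
    deriv (fun y : ℝ => g (a * y + c) * Complex.exp (k * y + d))
      = fun y : ℝ => (fun z => (a : ℂ) * deriv g z + k * g z) (a * y + c)
          * Complex.exp (k * y + d) := by
  funext y
  have h₁ : HasDerivAt (fun y : ℝ => a * y + c) a y := by
    simpa using ((hasDerivAt_id y).const_mul a).add_const c
  have h₂ := (hg (a * y + c)).hasDerivAt.scomp y h₁
  have h₃ : HasDerivAt (fun y : ℝ => k * (y : ℂ) + d) k y := by
    simpa using (Complex.ofRealCLM.hasDerivAt (x := y)).const_mul k |>.add_const d
  refine (h₂.mul h₃.cexp).deriv.trans ?_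
  simp only [Function.comp_apply, Complex.real_smul]
  ring

theorem deriv_const_mul_deriv_add {g : ℝ → ℂ} (hg : Differentiable ℝ g)
    (hg' : Differentiable ℝ (deriv g)) (a k : ℂ) :
    deriv (fun z => a * deriv g z + k * g z)
      = fun z => a * deriv (deriv g) z + k * deriv g z := by
  funext z
  exact (((hg' z).hasDerivAt.const_mul a).add ((hg z).hasDerivAt.const_mul k)).deriv

theorem iteratedDeriv_two_comp_affine_mul_exp {g : ℝ → ℂ} (hg : ContDiff ℝ (⊤ : ℕ∞) g)
    (a c : ℝ) (k d : ℂ) :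
    iteratedDeriv 2 (fun y : ℝ => g (a * y + c) * Complex.exp (k * y + d))
      = fun y : ℝ => (fun z => (a : ℂ) ^ 2 * iteratedDeriv 2 g z + 2 * a * k * deriv g z
          + k ^ 2 * g z) (a * y + c) * Complex.exp (k * y + d) := by
  have h₁ : ContDiff ℝ (⊤ : ℕ∞) (deriv g) := (contDiff_infty_iff_deriv.1 hg).2
  have d₀ : Differentiable ℝ g := hg.differentiable (by simp)
  have d₁ : Differentiable ℝ (deriv g) := h₁.differentiable (by simp)
  simp only [iteratedDeriv_succ, iteratedDeriv_zero]
  rw [deriv_comp_affine_mul_exp d₀,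
    deriv_comp_affine_mul_exp (g := fun z => (a : ℂ) * deriv g z + k * g z) (by fun_prop),
    deriv_const_mul_deriv_add d₀ d₁]
  funext y
  ring

theorem iteratedDeriv_three_comp_affine_mul_exp {g : ℝ → ℂ} (hg : ContDiff ℝ (⊤ : ℕ∞) g)
    (a c : ℝ) (k d : ℂ) :
    iteratedDeriv 3 (fun y : ℝ => g (a * y + c) * Complex.exp (k * y + d))
      = fun y : ℝ => (fun z => (a : ℂ) ^ 3 * iteratedDeriv 3 g z
          + 3 * a ^ 2 * k * iteratedDeriv 2 g z + 3 * a * k ^ 2 * deriv g z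
          + k ^ 3 * g z) (a * y + c) * Complex.exp (k * y + d) := by
  have h₁ : ContDiff ℝ (⊤ : ℕ∞) (deriv g) := (contDiff_infty_iff_deriv.1 hg).2
  have d₀ : Differentiable ℝ g := hg.differentiable (by simp)
  have d₁ : Differentiable ℝ (deriv g) := h₁.differentiable (by simp)
  have hG : ContDiff ℝ (⊤ : ℕ∞) (fun z => (a : ℂ) * deriv g z + k * g z) := by fun_prop
  rw [iteratedDeriv_succ', deriv_comp_affine_mul_exp d₀, iteratedDeriv_two_comp_affine_mul_exp hG]
  have h₂ : iteratedDeriv 2 (fun z => (a : ℂ) * deriv g z + k * g z)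
      = fun z => (a : ℂ) * iteratedDeriv 3 g z + k * iteratedDeriv 2 g z := by
    rw [iteratedDeriv_succ', deriv_const_mul_deriv_add d₀ d₁, iteratedDeriv_one,
      deriv_const_mul_deriv_add d₁
        ((contDiff_infty_iff_deriv.1 h₁).2.differentiable (by simp))]
    simp only [iteratedDeriv_succ, iteratedDeriv_zero]
  rw [h₂, deriv_const_mul_deriv_add d₀ d₁]
  simp only [iteratedDeriv_succ, iteratedDeriv_zero]
  funext y
  ring


open Complex ComplexConjugate

/-- Scaling–Galilean symmetry of the AKNS hierarchy truncated to the first two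
times: if `Ψ(x,t₁,t₂)` is a smooth joint solution of the first two reduced AKNS
hierarchy equations, then so is
`a Ψ(X, T₁, T₂) exp(−2ibx − i(2b)²t₁ − i(2b)³t₂)` with
`X = ax + 2a(2b)t₁ + 3a(2b)²t₂`, `T₁ = a²t₁ + 3(2b)a²t₂`, `T₂ = a³t₂`. -/
theorem akns2_galilean_scaling (a b : ℝ) (Ψ : ℝ → ℝ → ℝ → ℂ)
    (hΨ : ContDiff ℝ (⊤ : ℕ∞) ↿Ψ) (hsol : IsJointSolution12 Ψ) :
    ContDiff ℝ (⊤ : ℕ∞) ↿(fun x t₁ t₂ : ℝ =>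
        (a : ℂ) * Ψ (a * x + 2 * a * (2 * b) * t₁ + 3 * a * (2 * b) ^ 2 * t₂)
            (a ^ 2 * t₁ + 3 * (2 * b) * a ^ 2 * t₂) (a ^ 3 * t₂)
          * Complex.exp (-2 * Complex.I * (b : ℂ) * (x : ℂ)
              - Complex.I * (2 * (b : ℂ)) ^ 2 * (t₁ : ℂ)
              - Complex.I * (2 * (b : ℂ)) ^ 3 * (t₂ : ℂ))) ∧
    IsJointSolution12 (fun x t₁ t₂ : ℝ =>
        (a : ℂ) * Ψ (a * x + 2 * a * (2 * b) * t₁ + 3 * a * (2 * b) ^ 2 * t₂)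
            (a ^ 2 * t₁ + 3 * (2 * b) * a ^ 2 * t₂) (a ^ 3 * t₂)
          * Complex.exp (-2 * Complex.I * (b : ℂ) * (x : ℂ)
              - Complex.I * (2 * (b : ℂ)) ^ 2 * (t₁ : ℂ)
              - Complex.I * (2 * (b : ℂ)) ^ 3 * (t₂ : ℂ))) := by
  have hdiff : Differentiable ℝ ↿Ψ := hΨ.differentiable (by simp)
  have aff (p q s : ℝ) : HasDerivAt (fun r : ℝ => p + q * r) q s := by
    simpa using ((hasDerivAt_id s).const_mul q).const_add p
  have affC (p q : ℂ) (s : ℝ) : HasDerivAt (fun r : ℝ => p + q * (r : ℂ)) q s := by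
    simpa using ((Complex.ofRealCLM.hasDerivAt (x := s)).const_mul q).const_add p
  refine ⟨?_, fun x t₁ t₂ => ?_⟩
  · have hof : ContDiff ℝ (⊤ : ℕ∞) (fun r : ℝ => (r : ℂ)) := Complex.ofRealCLM.contDiff
    have hcomp : ContDiff ℝ (⊤ : ℕ∞) (fun p : ℝ × ℝ × ℝ =>
        Ψ (a * p.1 + 2 * a * (2 * b) * p.2.1 + 3 * a * (2 * b) ^ 2 * p.2.2)
          (a ^ 2 * p.2.1 + 3 * (2 * b) * a ^ 2 * p.2.2) (a ^ 3 * p.2.2)) :=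
      hΨ.comp (f := fun p : ℝ × ℝ × ℝ =>
        (a * p.1 + 2 * a * (2 * b) * p.2.1 + 3 * a * (2 * b) ^ 2 * p.2.2,
          a ^ 2 * p.2.1 + 3 * (2 * b) * a ^ 2 * p.2.2, a ^ 3 * p.2.2)) (by fun_prop)
    have h₀ : ContDiff ℝ (⊤ : ℕ∞) (fun p : ℝ × ℝ × ℝ => (p.1 : ℂ)) := hof.comp (by fun_prop)
    have h₁ : ContDiff ℝ (⊤ : ℕ∞) (fun p : ℝ × ℝ × ℝ => (p.2.1 : ℂ)) := hof.comp (by fun_prop)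
    have h₂ : ContDiff ℝ (⊤ : ℕ∞) (fun p : ℝ × ℝ × ℝ => (p.2.2 : ℂ)) := hof.comp (by fun_prop)
    exact (contDiff_const.mul hcomp).mul (((contDiff_const.mul h₀).sub
      (contDiff_const.mul h₁)).sub (contDiff_const.mul h₂)).cexp
  set T₁ : ℝ := a ^ 2 * t₁ + 3 * (2 * b) * a ^ 2 * t₂ with hT₁
  set T₂ : ℝ := a ^ 3 * t₂ with hT₂
  set c : ℝ := 2 * a * (2 * b) * t₁ + 3 * a * (2 * b) ^ 2 * t₂ with hc
  set X : ℝ := a * x + c with hX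
  set k : ℂ := -2 * Complex.I * b with hk
  set d : ℂ := -Complex.I * (2 * (b : ℂ)) ^ 2 * t₁ - Complex.I * (2 * (b : ℂ)) ^ 3 * t₂ with hd
  set g : ℝ → ℂ := fun y => Ψ y T₁ T₂ with hg
  set E : ℂ := Complex.exp (k * x + d) with hE
  have hgs : ContDiff ℝ (⊤ : ℕ∞) g :=
    hΨ.comp (f := fun y : ℝ => (y, T₁, T₂)) (by fun_prop)
  have hslice : (fun y : ℝ =>
        (a : ℂ) * Ψ (a * y + 2 * a * (2 * b) * t₁ + 3 * a * (2 * b) ^ 2 * t₂) T₁ T₂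
          * Complex.exp (-2 * Complex.I * (b : ℂ) * (y : ℂ)
              - Complex.I * (2 * (b : ℂ)) ^ 2 * (t₁ : ℂ)
              - Complex.I * (2 * (b : ℂ)) ^ 3 * (t₂ : ℂ)))
      = fun y : ℝ => (a : ℂ) * (g (a * y + c) * Complex.exp (k * y + d)) := by
    funext y
    rw [hg, hc, hk, hd, mul_assoc]
    have hy : a * y + 2 * a * (2 * b) * t₁ + 3 * a * (2 * b) ^ 2 * t₂
        = a * y + (2 * a * (2 * b) * t₁ + 3 * a * (2 * b) ^ 2 * t₂) := by ring
    rw [hy]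
    congr 3
    ring
  have hEE : E * conj E = 1 := by
    rw [hE, ← Complex.exp_conj, ← Complex.exp_add, hk, hd]
    simp only [map_add, map_sub, map_mul, map_neg, map_pow, Complex.conj_I, Complex.conj_ofReal,
      map_ofNat]
    rw [← Complex.exp_zero]
    congr 1
    ring
  obtain ⟨e₁, e₂⟩ := hsol X T₁ T₂
  have ht₁ : deriv (fun s : ℝ =>
        (a : ℂ) * Ψ (a * x + 2 * a * (2 * b) * s + 3 * a * (2 * b) ^ 2 * t₂)
            (a ^ 2 * s + 3 * (2 * b) * a ^ 2 * t₂) T₂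
          * Complex.exp (-2 * Complex.I * (b : ℂ) * (x : ℂ)
              - Complex.I * (2 * (b : ℂ)) ^ 2 * (s : ℂ)
              - Complex.I * (2 * (b : ℂ)) ^ 3 * (t₂ : ℂ))) t₁
      = a * ((2 * a * (2 * b)) * deriv g X + a ^ 2 * deriv (fun s => Ψ X s T₂) T₁
          - Complex.I * (2 * b) ^ 2 * g X) * E := by
    have hu := aff (a * x + 3 * a * (2 * b) ^ 2 * t₂) (2 * a * (2 * b)) t₁
    have hv := aff (3 * (2 * b) * a ^ 2 * t₂) (a ^ 2) t₁
    have hw := hasDerivAt_const t₁ T₂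
    have hp := affC (k * x - Complex.I * (2 * (b : ℂ)) ^ 3 * t₂)
      (-Complex.I * (2 * (b : ℂ)) ^ 2) t₁
    have h := ((hasDerivAt_comp_curve (hdiff _) hu hv hw).const_mul (a : ℂ)).mul hp.cexp
    have eX : a * x + 3 * a * (2 * b) ^ 2 * t₂ + 2 * a * (2 * b) * t₁ = X := by
      rw [hX, hc]; ring
    have eT : 3 * (2 * b) * a ^ 2 * t₂ + a ^ 2 * t₁ = T₁ := by rw [hT₁]; ring
    have eE : k * x - Complex.I * (2 * (b : ℂ)) ^ 3 * t₂
        + -Complex.I * (2 * (b : ℂ)) ^ 2 * t₁ = k * x + d := by rw [hd]; ring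
    simp only [eX, eT, eE] at h
    refine (congrArg (fun f => deriv f t₁) ?_).trans (h.deriv.trans ?_)
    · funext s
      simp only [Pi.mul_apply, hk]
      refine congrArg₂ (· * ·) (congrArg ((a : ℂ) * ·)
        (congrArg₂ (fun p q => Ψ p q T₂) ?_ ?_)) (congrArg Complex.exp ?_) <;> ring
    · simp only [hg, hE]
      push_cast
      ring
  have ht₂ : deriv (fun s : ℝ =>
        (a : ℂ) * Ψ (a * x + 2 * a * (2 * b) * t₁ + 3 * a * (2 * b) ^ 2 * s)
            (a ^ 2 * t₁ + 3 * (2 * b) * a ^ 2 * s) (a ^ 3 * s)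
          * Complex.exp (-2 * Complex.I * (b : ℂ) * (x : ℂ)
              - Complex.I * (2 * (b : ℂ)) ^ 2 * (t₁ : ℂ)
              - Complex.I * (2 * (b : ℂ)) ^ 3 * (s : ℂ))) t₂
      = a * ((3 * a * (2 * b) ^ 2) * deriv g X
          + 3 * (2 * b) * a ^ 2 * deriv (fun s => Ψ X s T₂) T₁
          + a ^ 3 * deriv (fun s => Ψ X T₁ s) T₂
          - Complex.I * (2 * b) ^ 3 * g X) * E := by
    have hu := aff (a * x + 2 * a * (2 * b) * t₁) (3 * a * (2 * b) ^ 2) t₂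
    have hv := aff (a ^ 2 * t₁) (3 * (2 * b) * a ^ 2) t₂
    have hw := aff 0 (a ^ 3) t₂
    have hp := affC (k * x - Complex.I * (2 * (b : ℂ)) ^ 2 * t₁)
      (-Complex.I * (2 * (b : ℂ)) ^ 3) t₂
    have h := ((hasDerivAt_comp_curve (hdiff _) hu hv hw).const_mul (a : ℂ)).mul hp.cexp
    have eX : a * x + 2 * a * (2 * b) * t₁ + 3 * a * (2 * b) ^ 2 * t₂ = X := by
      rw [hX, hc]; ring
    have eT : 0 + a ^ 3 * t₂ = T₂ := by rw [hT₂]; ring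
    have eE : k * x - Complex.I * (2 * (b : ℂ)) ^ 2 * t₁
        + -Complex.I * (2 * (b : ℂ)) ^ 3 * t₂ = k * x + d := by rw [hd]; ring
    simp only [eX, eT, eE, ← hT₁] at h
    refine (congrArg (fun f => deriv f t₂) ?_).trans (h.deriv.trans ?_)
    · funext s
      simp only [Pi.mul_apply, hk]
      congr 3
      · ring
      · ring
    · simp only [hg, hE]
      push_cast
      ring
  have hval : (a : ℂ) * Ψ (a * x + 2 * a * (2 * b) * t₁ + 3 * a * (2 * b) ^ 2 * t₂) T₁ T₂
      * Complex.exp (-2 * Complex.I * (b : ℂ) * (x : ℂ) - Complex.I * (2 * (b : ℂ)) ^ 2 * (t₁ : ℂ)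
        - Complex.I * (2 * (b : ℂ)) ^ 3 * (t₂ : ℂ)) = a * (g X * E) := congrFun hslice x
  have hx₁ : deriv (fun y : ℝ => (a : ℂ) * (g (a * y + c) * Complex.exp (k * y + d))) x
      = a * ((a * deriv g X + k * g X) * E) := by
    rw [deriv_const_mul_field, deriv_comp_affine_mul_exp (hgs.differentiable (by simp))]
  have hx₂ : iteratedDeriv 2 (fun y : ℝ => (a : ℂ) * (g (a * y + c) * Complex.exp (k * y + d))) x
      = a * (((a : ℂ) ^ 2 * iteratedDeriv 2 g X + 2 * a * k * deriv g X + k ^ 2 * g X) * E) := by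
    rw [iteratedDeriv_const_mul_field, iteratedDeriv_two_comp_affine_mul_exp hgs]
  have hx₃ : iteratedDeriv 3 (fun y : ℝ => (a : ℂ) * (g (a * y + c) * Complex.exp (k * y + d))) x
      = a * (((a : ℂ) ^ 3 * iteratedDeriv 3 g X + 3 * a ^ 2 * k * iteratedDeriv 2 g X
          + 3 * a * k ^ 2 * deriv g X + k ^ 3 * g X) * E) := by
    rw [iteratedDeriv_const_mul_field, iteratedDeriv_three_comp_affine_mul_exp hgs]
  have hI : Complex.I ^ 2 = -1 := Complex.I_sq
  simp only [H1, H2] at e₁ e₂ ⊢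
  simp only [← hT₁, ← hT₂]
  rw [ht₁, ht₂, hslice, hx₁, hx₂, hx₃, hval]
  simp only [map_mul, Complex.conj_ofReal]
  change Complex.I * deriv (fun s => Ψ X s T₂) T₁ + (iteratedDeriv 2 g X
    + 2 * (g X * conj (g X)) * g X) = 0 at e₁
  change deriv (fun s => Ψ X T₁ s) T₂ + (iteratedDeriv 3 g X
    + 6 * (g X * conj (g X)) * deriv g X) = 0 at e₂
  generalize deriv (fun s => Ψ X s T₂) T₁ = p at *
  generalize deriv (fun s => Ψ X T₁ s) T₂ = q at *
  generalize iteratedDeriv 2 g X = g₂ at *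
  generalize iteratedDeriv 3 g X = g₃ at *
  generalize deriv g X = g₁ at *
  generalize conj (g X) = h at *
  generalize g X = g₀ at *
  generalize conj E = E' at *
  rw [hk]
  constructor
  · linear_combination (a : ℂ) ^ 3 * E * e₁ + 2 * (a : ℂ) ^ 3 * g₀ ^ 2 * h * E * hEE
  · linear_combination (a : ℂ) ^ 4 * E * e₂ - 6 * Complex.I * (a : ℂ) ^ 3 * b * E * e₁
      + 6 * (a : ℂ) ^ 3 * g₀ * h * (a * g₁ + -2 * Complex.I * b * g₀) * E * hEE
      + (6 * (a : ℂ) ^ 3 * b * E * p + 12 * (a : ℂ) ^ 2 * b ^ 2 * g₁ * E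
        - 8 * Complex.I * (b : ℂ) ^ 3 * a * g₀ * E) * hI
end

section
/- Let a, b ∈ ℝ and let Ψ : ℝ⁴ → ℂ, (x,t₁,t₂,t₃) ↦ Ψ(x,t₁,t₂,t₃), be a smooth joint solution of the first three reduced AKNS hierarchy equations: i Ψ_{t₁} + H₁(Ψ) = 0, Ψ_{t₂} + H₂(Ψ) = 0, and −i Ψ_{t₃} + H₃(Ψ) = 0. Define X := ax + 2a(2b)t₁ + 3a(2b)²t₂ + 4a(2b)³t₃, T₁ := a²t₁ + 3a²(2b)t₂ + 6a²(2b)²t₃, T₂ := a³t₂ + 4a³(2b)t₃, T₃ := a⁴t₃, and Ψ̃(x,t₁,t₂,t₃) := a·Ψ(X, T₁, T₂, T₃)·exp(−2ibx − i(2b)²t₁ − i(2b)³t₂ − i(2b)⁴t₃). Then Ψ̃ is also a smooth joint solution of the first three reduced AKNS hierarchy equations. -/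
open Complex ComplexConjugate

/-- The third AKNS flow operator
`H₃(f) = f_xxxx + 8|f|²f_xx + 2f²(conj f)_xx + 6f_x² conj f + 4f|f_x|² + 6|f|⁴f`
for a function of `x`. -/
noncomputable def H3 (f : ℝ → ℂ) (x : ℝ) : ℂ :=
  iteratedDeriv 4 f x
    + 8 * (f x * conj (f x)) * iteratedDeriv 2 f x
    + 2 * (f x) ^ 2 * iteratedDeriv 2 (fun y => conj (f y)) x
    + 6 * (deriv f x) ^ 2 * conj (f x)
    + 4 * f x * (deriv f x * conj (deriv f x))
    + 6 * (f x * conj (f x)) ^ 2 * f x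

/-- `Ψ (x, t₁, t₂, t₃)` is a joint solution of the first three reduced AKNS
hierarchy equations: `i Ψ_{t₁} + H₁(Ψ) = 0`, `Ψ_{t₂} + H₂(Ψ) = 0`,
`−i Ψ_{t₃} + H₃(Ψ) = 0`. -/
def IsJointSolution123 (Ψ : ℝ → ℝ → ℝ → ℝ → ℂ) : Prop :=
  ∀ x t₁ t₂ t₃ : ℝ,
    Complex.I * deriv (fun s => Ψ x s t₂ t₃) t₁ + H1 (fun y => Ψ y t₁ t₂ t₃) x = 0 ∧
    deriv (fun s => Ψ x t₁ s t₃) t₂ + H2 (fun y => Ψ y t₁ t₂ t₃) x = 0 ∧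
    -Complex.I * deriv (fun s => Ψ x t₁ t₂ s) t₃ + H3 (fun y => Ψ y t₁ t₂ t₃) x = 0

section GaugeTransform

variable {f e : ℝ → ℂ} {k : ℂ}

lemma iteratedDeriv_eq_pow_mul_of_hasDerivAt (he : ∀ y, HasDerivAt e (k * e y) y) (n : ℕ) :
    iteratedDeriv n e = fun y => k ^ n * e y := by
  induction n with
  | zero => simp
  | succ n ih =>
    rw [iteratedDeriv_succ, ih]
    funext y
    rw [((he y).const_mul (k ^ n)).deriv]
    ring

lemma contDiff_of_hasDerivAt_const_mul (he : ∀ y, HasDerivAt e (k * e y) y) :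
    ContDiff ℝ (⊤ : ℕ∞) e := by
  refine contDiff_of_differentiable_iteratedDeriv fun n _ => ?_
  rw [iteratedDeriv_eq_pow_mul_of_hasDerivAt he]
  exact fun y => ((he y).const_mul (k ^ n)).differentiableAt

lemma iteratedDeriv_comp_mul_add_const (hf : ContDiff ℝ (⊤ : ℕ∞) f) (a c : ℝ) (n : ℕ) (x : ℝ) :
    iteratedDeriv n (fun y => f (a * y + c)) x = (a : ℂ) ^ n * iteratedDeriv n f (a * x + c) := by
  have hshift : ContDiff ℝ n fun z => f (z + c) :=
    (hf.of_le (by exact_mod_cast le_top)).comp (contDiff_id.add contDiff_const)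
  have h := congrFun (iteratedDeriv_comp_const_smul hshift a) x
  rw [iteratedDeriv_comp_add_const] at h
  simpa using h

/-- Leibniz rule for `a * f (a * y + c)` times a factor `e` with logarithmic derivative `k`. -/
lemma iteratedDeriv_gauge (hf : ContDiff ℝ (⊤ : ℕ∞) f)
    (he : ∀ y, HasDerivAt e (k * e y) y) (a c : ℝ) (n : ℕ) (x : ℝ) :
    iteratedDeriv n (fun y => a * f (a * y + c) * e y) x =
      a * (∑ i ∈ Finset.range (n + 1),
        n.choose i * a ^ i * k ^ (n - i) * iteratedDeriv i f (a * x + c)) * e x := by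
  have hf' : ContDiff ℝ n fun y => f (a * y + c) :=
    (hf.of_le (by exact_mod_cast le_top)).comp ((contDiff_const.mul contDiff_id).add contDiff_const)
  have he' : ContDiff ℝ n e :=
    (contDiff_of_hasDerivAt_const_mul he).of_le (by exact_mod_cast le_top)
  simp_rw [mul_assoc]
  rw [iteratedDeriv_const_mul_field, iteratedDeriv_fun_mul hf'.contDiffAt he'.contDiffAt,
    Finset.sum_mul]
  congr 1
  refine Finset.sum_congr rfl fun i _ => ?_
  rw [iteratedDeriv_comp_mul_add_const hf, iteratedDeriv_eq_pow_mul_of_hasDerivAt he]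
  ring

lemma iteratedDeriv_two_conj (f : ℝ → ℂ) (x : ℝ) :
    iteratedDeriv 2 (fun y => conj (f y)) x = conj (iteratedDeriv 2 f x) := by
  simp only [iteratedDeriv_succ, iteratedDeriv_zero, starRingEnd_apply, deriv.star']

end GaugeTransform

section GalileanGauge

variable {f e : ℝ → ℂ} {b : ℝ}

lemma H1_gauge (hf : ContDiff ℝ (⊤ : ℕ∞) f) (he : ∀ y, HasDerivAt e (-2 * I * b * e y) y)
    (hn : ∀ y, e y * conj (e y) = 1) (a c x : ℝ) :
    H1 (fun y => a * f (a * y + c) * e y) x =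
      a * (a ^ 2 * H1 f (a * x + c) - 4 * I * a * b * deriv f (a * x + c)
        - 4 * b ^ 2 * f (a * x + c)) * e x := by
  simp only [H1, iteratedDeriv_gauge hf he, Finset.sum_range_succ, Finset.sum_range_zero,
    iteratedDeriv_zero, iteratedDeriv_one, map_mul, conj_ofReal]
  norm_num [Nat.choose]
  linear_combination (2 * a ^ 3 * f (a * x + c) ^ 2 * conj (f (a * x + c)) * e x) * hn x
    + (4 * a * b ^ 2 * f (a * x + c) * e x) * I_sq

lemma H2_gauge (hf : ContDiff ℝ (⊤ : ℕ∞) f) (he : ∀ y, HasDerivAt e (-2 * I * b * e y) y)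
    (hn : ∀ y, e y * conj (e y) = 1) (a c x : ℝ) :
    H2 (fun y => a * f (a * y + c) * e y) x =
      a * (a ^ 3 * H2 f (a * x + c) - 6 * I * a ^ 2 * b * H1 f (a * x + c)
        - 12 * a * b ^ 2 * deriv f (a * x + c) + 8 * I * b ^ 3 * f (a * x + c)) * e x := by
  rw [H2, ← iteratedDeriv_one]
  simp only [H1, H2, iteratedDeriv_gauge hf he, Finset.sum_range_succ, Finset.sum_range_zero,
    iteratedDeriv_zero, iteratedDeriv_one, map_mul, conj_ofReal]
  norm_num [Nat.choose]
  generalize deriv f (a * x + c) = p1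
  generalize f (a * x + c) = p0
  linear_combination (6 * a ^ 3 * p0 * conj p0 * e x * (a * p1 - 2 * I * b * p0)) * hn x
    + (12 * a ^ 2 * b ^ 2 * p1 * e x - 8 * I * a * b ^ 3 * p0 * e x) * I_sq

lemma H3_gauge (hf : ContDiff ℝ (⊤ : ℕ∞) f) (he : ∀ y, HasDerivAt e (-2 * I * b * e y) y)
    (hn : ∀ y, e y * conj (e y) = 1) (a c x : ℝ) :
    H3 (fun y => a * f (a * y + c) * e y) x =
      a * (a ^ 4 * H3 f (a * x + c) - 8 * I * a ^ 3 * b * H2 f (a * x + c)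
        - 24 * a ^ 2 * b ^ 2 * H1 f (a * x + c) + 32 * I * a * b ^ 3 * deriv f (a * x + c)
        + 16 * b ^ 4 * f (a * x + c)) * e x := by
  rw [H3, ← iteratedDeriv_one, iteratedDeriv_two_conj]
  simp only [H1, H2, H3, iteratedDeriv_two_conj, iteratedDeriv_gauge hf he, Finset.sum_range_succ,
    Finset.sum_range_zero, iteratedDeriv_zero, iteratedDeriv_one, map_mul, map_add, map_pow,
    conj_ofReal]
  norm_num [Nat.choose, Complex.conj_ofNat]
  have hn := hn x
  generalize iteratedDeriv 4 f (a * x + c) = p4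
  generalize iteratedDeriv 3 f (a * x + c) = p3
  generalize iteratedDeriv 2 f (a * x + c) = p2
  generalize deriv f (a * x + c) = p1
  generalize f (a * x + c) = p0
  have h0 : e x ≠ 0 := left_ne_zero_of_mul_eq_one hn
  rw [eq_inv_of_mul_eq_one_right hn]
  field_simp
  ring_nf
  simp only [I_sq, I_pow_three, I_pow_four]
  ring

/-- Chain rule for a function of four real variables along a differentiable curve. -/
lemma hasDerivAt_comp_curve_s9 {Ψ : ℝ → ℝ → ℝ → ℝ → ℂ} (hΨ : Differentiable ℝ ↿Ψ)
    {X T₁ T₂ T₃ : ℝ → ℝ} {X' T₁' T₂' T₃' s : ℝ} (hX : HasDerivAt X X' s)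
    (h₁ : HasDerivAt T₁ T₁' s) (h₂ : HasDerivAt T₂ T₂' s) (h₃ : HasDerivAt T₃ T₃' s) :
    HasDerivAt (fun r => Ψ (X r) (T₁ r) (T₂ r) (T₃ r))
      (X' * deriv (fun r => Ψ r (T₁ s) (T₂ s) (T₃ s)) (X s)
        + T₁' * deriv (fun r => Ψ (X s) r (T₂ s) (T₃ s)) (T₁ s)
        + T₂' * deriv (fun r => Ψ (X s) (T₁ s) r (T₃ s)) (T₂ s)
        + T₃' * deriv (fun r => Ψ (X s) (T₁ s) (T₂ s) r) (T₃ s)) s := by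
  let p : ℝ × ℝ × ℝ × ℝ := (X s, T₁ s, T₂ s, T₃ s)
  let L := fderiv ℝ ↿Ψ p
  have hL : HasFDerivAt ↿Ψ L p := (hΨ p).hasFDerivAt
  have curve {Y S₁ S₂ S₃ : ℝ → ℝ} {Y' S₁' S₂' S₃' r : ℝ} (hY : HasDerivAt Y Y' r)
      (k₁ : HasDerivAt S₁ S₁' r) (k₂ : HasDerivAt S₂ S₂' r) (k₃ : HasDerivAt S₃ S₃' r)
      (hp : p = (Y r, S₁ r, S₂ r, S₃ r)) :
      HasDerivAt (fun r => Ψ (Y r) (S₁ r) (S₂ r) (S₃ r)) (L (Y', S₁', S₂', S₃')) r :=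
    HasFDerivAt.comp_hasDerivAt (l := ↿Ψ) (f := fun r => (Y r, S₁ r, S₂ r, S₃ r)) r (hp ▸ hL)
      (hY.prodMk (k₁.prodMk (k₂.prodMk k₃)))
  have c (z r : ℝ) : HasDerivAt (fun _ : ℝ => z) 0 r := hasDerivAt_const r z
  rw [(curve (hasDerivAt_id' (X s)) (c (T₁ s) _) (c (T₂ s) _) (c (T₃ s) _) rfl).deriv,
    (curve (c (X s) _) (hasDerivAt_id' (T₁ s)) (c (T₂ s) _) (c (T₃ s) _) rfl).deriv,
    (curve (c (X s) _) (c (T₁ s) _) (hasDerivAt_id' (T₂ s)) (c (T₃ s) _) rfl).deriv,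
    (curve (c (X s) _) (c (T₁ s) _) (c (T₂ s) _) (hasDerivAt_id' (T₃ s)) rfl).deriv]
  convert curve hX h₁ h₂ h₃ rfl using 1
  simp only [← Complex.real_smul, ← map_smul, ← map_add]
  simp

lemma hasDerivAt_of_eq_smul_add {E : Type*} [NormedAddCommGroup E] [NormedSpace ℝ E]
    {g : ℝ → E} {m : E} (h : ∀ r, g r = r • m + g 0) (s : ℝ) : HasDerivAt g m s := by
  rw [funext h]
  simpa using ((hasDerivAt_id s).smul_const m).add_const (g 0)

/-- Derivative of a gauge-transformed function of four variables along an affine line. -/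
lemma deriv_gauge_line {Ψ : ℝ → ℝ → ℝ → ℝ → ℂ} (hΨ : Differentiable ℝ ↿Ψ) (a : ℂ)
    {X T₁ T₂ T₃ : ℝ → ℝ} {φ : ℝ → ℂ} (X' T₁' T₂' T₃' : ℝ) (φ' : ℂ)
    (hX : ∀ r, X r = r • X' + X 0) (h₁ : ∀ r, T₁ r = r • T₁' + T₁ 0)
    (h₂ : ∀ r, T₂ r = r • T₂' + T₂ 0) (h₃ : ∀ r, T₃ r = r • T₃' + T₃ 0)
    (hφ : ∀ r, φ r = r • φ' + φ 0) (s : ℝ) :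
    deriv (fun r => a * Ψ (X r) (T₁ r) (T₂ r) (T₃ r) * Complex.exp (φ r)) s =
      a * (X' * deriv (fun r => Ψ r (T₁ s) (T₂ s) (T₃ s)) (X s)
        + T₁' * deriv (fun r => Ψ (X s) r (T₂ s) (T₃ s)) (T₁ s)
        + T₂' * deriv (fun r => Ψ (X s) (T₁ s) r (T₃ s)) (T₂ s)
        + T₃' * deriv (fun r => Ψ (X s) (T₁ s) (T₂ s) r) (T₃ s)
        + φ' * Ψ (X s) (T₁ s) (T₂ s) (T₃ s)) * Complex.exp (φ s) := by
  rw [(((hasDerivAt_comp_curve_s9 hΨ (hasDerivAt_of_eq_smul_add hX s)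
    (hasDerivAt_of_eq_smul_add h₁ s) (hasDerivAt_of_eq_smul_add h₂ s)
    (hasDerivAt_of_eq_smul_add h₃ s)).const_mul a).fun_mul
    (hasDerivAt_of_eq_smul_add hφ s).cexp).deriv]
  ring

end GalileanGauge

/-- Scaling–Galilean symmetry of the AKNS hierarchy truncated to the first three
times (Theorem 1 of the paper): if `Ψ(x,t₁,t₂,t₃)` is a smooth joint solution of
the first three reduced AKNS hierarchy equations, then so is
`a Ψ(X, T₁, T₂, T₃) exp(−2ibx − i(2b)²t₁ − i(2b)³t₂ − i(2b)⁴t₃)` with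
`X = ax + 2a(2b)t₁ + 3a(2b)²t₂ + 4a(2b)³t₃`,
`T₁ = a²t₁ + 3a²(2b)t₂ + 6a²(2b)²t₃`, `T₂ = a³t₂ + 4a³(2b)t₃`, `T₃ = a⁴t₃`. -/
theorem akns3_galilean_scaling (a b : ℝ) (Ψ : ℝ → ℝ → ℝ → ℝ → ℂ)
    (hΨ : ContDiff ℝ (⊤ : ℕ∞) ↿Ψ) (hsol : IsJointSolution123 Ψ) :
    ContDiff ℝ (⊤ : ℕ∞) ↿(fun x t₁ t₂ t₃ : ℝ =>
        (a : ℂ) * Ψ (a * x + 2 * a * (2 * b) * t₁ + 3 * a * (2 * b) ^ 2 * t₂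
              + 4 * a * (2 * b) ^ 3 * t₃)
            (a ^ 2 * t₁ + 3 * a ^ 2 * (2 * b) * t₂ + 6 * a ^ 2 * (2 * b) ^ 2 * t₃)
            (a ^ 3 * t₂ + 4 * a ^ 3 * (2 * b) * t₃) (a ^ 4 * t₃)
          * Complex.exp (-2 * Complex.I * (b : ℂ) * (x : ℂ)
              - Complex.I * (2 * (b : ℂ)) ^ 2 * (t₁ : ℂ)
              - Complex.I * (2 * (b : ℂ)) ^ 3 * (t₂ : ℂ)
              - Complex.I * (2 * (b : ℂ)) ^ 4 * (t₃ : ℂ))) ∧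
    IsJointSolution123 (fun x t₁ t₂ t₃ : ℝ =>
        (a : ℂ) * Ψ (a * x + 2 * a * (2 * b) * t₁ + 3 * a * (2 * b) ^ 2 * t₂
              + 4 * a * (2 * b) ^ 3 * t₃)
            (a ^ 2 * t₁ + 3 * a ^ 2 * (2 * b) * t₂ + 6 * a ^ 2 * (2 * b) ^ 2 * t₃)
            (a ^ 3 * t₂ + 4 * a ^ 3 * (2 * b) * t₃) (a ^ 4 * t₃)
          * Complex.exp (-2 * Complex.I * (b : ℂ) * (x : ℂ)
              - Complex.I * (2 * (b : ℂ)) ^ 2 * (t₁ : ℂ)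
              - Complex.I * (2 * (b : ℂ)) ^ 3 * (t₂ : ℂ)
              - Complex.I * (2 * (b : ℂ)) ^ 4 * (t₃ : ℂ))) := by
  have hd : Differentiable ℝ ↿Ψ := hΨ.differentiable (by simp)
  refine ⟨?_, fun x t₁ t₂ t₃ => ?_⟩
  · have hofReal : ContDiff ℝ (⊤ : ℕ∞) (fun r : ℝ => (r : ℂ)) := ofRealCLM.contDiff
    refine (contDiff_const.mul (hΨ.comp (g := ↿Ψ) (f := fun p : ℝ × ℝ × ℝ × ℝ =>
      (a * p.1 + 2 * a * (2 * b) * p.2.1 + 3 * a * (2 * b) ^ 2 * p.2.2.1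
          + 4 * a * (2 * b) ^ 3 * p.2.2.2,
        a ^ 2 * p.2.1 + 3 * a ^ 2 * (2 * b) * p.2.2.1 + 6 * a ^ 2 * (2 * b) ^ 2 * p.2.2.2,
        a ^ 3 * p.2.2.1 + 4 * a ^ 3 * (2 * b) * p.2.2.2, a ^ 4 * p.2.2.2)) ?_)).mul
      (ContDiff.cexp ?_)
    · fun_prop
    · fun_prop
  set X := a * x + 2 * a * (2 * b) * t₁ + 3 * a * (2 * b) ^ 2 * t₂ + 4 * a * (2 * b) ^ 3 * t₃
    with hX
  set T₁ := a ^ 2 * t₁ + 3 * a ^ 2 * (2 * b) * t₂ + 6 * a ^ 2 * (2 * b) ^ 2 * t₃ with hT₁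
  set T₂ := a ^ 3 * t₂ + 4 * a ^ 3 * (2 * b) * t₃ with hT₂
  set T₃ := a ^ 4 * t₃ with hT₃
  set c := 2 * a * (2 * b) * t₁ + 3 * a * (2 * b) ^ 2 * t₂ + 4 * a * (2 * b) ^ 3 * t₃ with hc
  have hXc : a * x + c = X := by rw [hX, hc]; ring
  set f : ℝ → ℂ := fun y => Ψ y T₁ T₂ T₃ with hf
  have hfs : ContDiff ℝ (⊤ : ℕ∞) f :=
    hΨ.comp (g := ↿Ψ) (f := fun y => (y, T₁, T₂, T₃)) (contDiff_id.prodMk contDiff_const)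
  set e : ℝ → ℂ := fun y => Complex.exp (-2 * Complex.I * (b : ℂ) * (y : ℂ)
    - Complex.I * (2 * (b : ℂ)) ^ 2 * (t₁ : ℂ) - Complex.I * (2 * (b : ℂ)) ^ 3 * (t₂ : ℂ)
    - Complex.I * (2 * (b : ℂ)) ^ 4 * (t₃ : ℂ)) with he
  have hed (y : ℝ) : HasDerivAt e (-2 * I * b * e y) y := by
    rw [mul_comm]
    refine (hasDerivAt_of_eq_smul_add (fun r => ?_) y).cexp
    simp only [real_smul, ofReal_zero]
    ring
  have hen (y : ℝ) : e y * conj (e y) = 1 := by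
    simp only [he, ← exp_conj, ← Complex.exp_add]
    simp [Complex.conj_ofNat]
  have hshift : (fun y : ℝ => (a : ℂ) * Ψ (a * y + 2 * a * (2 * b) * t₁
      + 3 * a * (2 * b) ^ 2 * t₂ + 4 * a * (2 * b) ^ 3 * t₃) T₁ T₂ T₃ * e y) =
      fun y => a * f (a * y + c) * e y := by
    funext y
    simp only [hf, hc]
    ring_nf
  obtain ⟨h₁, h₂, h₃⟩ := hsol X T₁ T₂ T₃
  refine ⟨?_, ?_, ?_⟩
  · rw [deriv_gauge_line hd a (2 * a * (2 * b)) (a ^ 2) 0 0 (-(I * (2 * b) ^ 2)), hshift,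
      H1_gauge hfs hed hen, hXc]
    · simp only [← hX, ← hT₁, ← hT₂, ← hT₃]
      push_cast
      linear_combination a ^ 3 * e x * h₁ - 4 * a * b ^ 2 * f X * e x * I_sq
    all_goals intro r; simp only [smul_eq_mul, real_smul, ofReal_zero]; ring
  · rw [deriv_gauge_line hd a (3 * a * (2 * b) ^ 2) (3 * a ^ 2 * (2 * b)) (a ^ 3) 0
      (-(I * (2 * b) ^ 3)), hshift, H2_gauge hfs hed hen, hXc]
    · simp only [← hX, ← hT₁, ← hT₂, ← hT₃]
      push_cast
      linear_combination a ^ 4 * e x * h₂ - 6 * I * a ^ 3 * b * e x * h₁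
        + 6 * a ^ 3 * b * deriv (fun r => Ψ X r T₂ T₃) T₁ * e x * I_sq
    all_goals intro r; simp only [smul_eq_mul, real_smul, ofReal_zero]; ring
  · rw [deriv_gauge_line hd a (4 * a * (2 * b) ^ 3) (6 * a ^ 2 * (2 * b) ^ 2)
      (4 * a ^ 3 * (2 * b)) (a ^ 4) (-(I * (2 * b) ^ 4)), hshift, H3_gauge hfs hed hen, hXc]
    · simp only [← hX, ← hT₁, ← hT₂, ← hT₃]
      push_cast
      linear_combination a ^ 5 * e x * h₃ - 8 * I * a ^ 4 * b * e x * h₂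
        - 24 * a ^ 3 * b ^ 2 * e x * h₁ + 16 * a * b ^ 4 * f X * e x * I_sq
    all_goals intro r; simp only [smul_eq_mul, real_smul, ofReal_zero]; ring
end

section
/- Let ψ, φ : ℝ × ℝ → ℂ be smooth functions of (x,t). Define the 2×2 complex matrices J := diag(−i, i), U⁰ := [[0, iψ],[−iφ, 0]], V₁⁰ := [[−iψφ, −ψ_x],[−φ_x, iψφ]], V₂⁰ := [[ψ_xφ − φ_xψ, 2iψ²φ − iψ_xx],[−2iφ²ψ + iφ_xx, φ_xψ − ψ_xφ]], and for λ ∈ ℂ set U(λ) := λJ + U⁰ and V₂(λ) := 4λ³J + 4λ²U⁰ + 2λV₁⁰ + V₂⁰. Then the zero-curvature equation U(λ)_t − (V₂(λ))_x + [U(λ), V₂(λ)] = 0 holds for all λ ∈ ℂ if and only if ψ and φ satisfy the coupled mKdV system: ψ_t + ψ_xxx − 6ψφψ_x = 0 and φ_t + φ_xxx − 6ψφφ_x = 0. -/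
open Complex ComplexConjugate

/-- The `n`-th partial derivative in `x` of a function `ψ (x, t)`. -/
noncomputable def Dx (n : ℕ) (ψ : ℝ → ℝ → ℂ) (x t : ℝ) : ℂ :=
  iteratedDeriv n (fun x' => ψ x' t) x

/-- The partial derivative in `t` of a function `ψ (x, t)`. -/
noncomputable def Dt (ψ : ℝ → ℝ → ℂ) (x t : ℝ) : ℂ :=
  deriv (fun t' => ψ x t') t

/-- Entrywise partial derivative in `x` of a matrix-valued function of `(x, t)`. -/
noncomputable def MDx (M : ℝ → ℝ → Matrix (Fin 2) (Fin 2) ℂ) (x t : ℝ) :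
    Matrix (Fin 2) (Fin 2) ℂ :=
  Matrix.of fun i j => deriv (fun x' => M x' t i j) x

/-- Entrywise partial derivative in `t` of a matrix-valued function of `(x, t)`. -/
noncomputable def MDt (M : ℝ → ℝ → Matrix (Fin 2) (Fin 2) ℂ) (x t : ℝ) :
    Matrix (Fin 2) (Fin 2) ℂ :=
  Matrix.of fun i j => deriv (fun t' => M x t' i j) t

/-- `J = diag(−i, i)`. -/
noncomputable def Jmat : Matrix (Fin 2) (Fin 2) ℂ :=
  !![-Complex.I, 0; 0, Complex.I]

/-- `U⁰ = [[0, iψ], [−iφ, 0]]`. -/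
noncomputable def U0 (ψ φ : ℝ → ℝ → ℂ) (x t : ℝ) : Matrix (Fin 2) (Fin 2) ℂ :=
  !![0, Complex.I * ψ x t; -Complex.I * φ x t, 0]

/-- `V₁⁰ = [[−iψφ, −ψ_x], [−φ_x, iψφ]]`. -/
noncomputable def V10 (ψ φ : ℝ → ℝ → ℂ) (x t : ℝ) : Matrix (Fin 2) (Fin 2) ℂ :=
  !![-Complex.I * ψ x t * φ x t, -(Dx 1 ψ x t);
     -(Dx 1 φ x t), Complex.I * ψ x t * φ x t]

/-- `V₂⁰ = [[ψ_xφ − φ_xψ, 2iψ²φ − iψ_xx], [−2iφ²ψ + iφ_xx, φ_xψ − ψ_xφ]]`. -/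
noncomputable def V20 (ψ φ : ℝ → ℝ → ℂ) (x t : ℝ) : Matrix (Fin 2) (Fin 2) ℂ :=
  !![Dx 1 ψ x t * φ x t - Dx 1 φ x t * ψ x t,
     2 * Complex.I * (ψ x t) ^ 2 * φ x t - Complex.I * Dx 2 ψ x t;
     -2 * Complex.I * (φ x t) ^ 2 * ψ x t + Complex.I * Dx 2 φ x t,
     Dx 1 φ x t * ψ x t - Dx 1 ψ x t * φ x t]

/-- `U(λ) = λ J + U⁰`. -/
noncomputable def Umat (ψ φ : ℝ → ℝ → ℂ) (lam : ℂ) (x t : ℝ) :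
    Matrix (Fin 2) (Fin 2) ℂ :=
  lam • Jmat + U0 ψ φ x t

/-- `V₂(λ) = 4λ³ J + 4λ² U⁰ + 2λ V₁⁰ + V₂⁰`. -/
noncomputable def V2mat (ψ φ : ℝ → ℝ → ℂ) (lam : ℂ) (x t : ℝ) :
    Matrix (Fin 2) (Fin 2) ℂ :=
  (4 * lam ^ 3) • Jmat + (4 * lam ^ 2) • U0 ψ φ x t
    + (2 * lam) • V10 ψ φ x t + V20 ψ φ x t

theorem hasDerivAt_Dx {ψ : ℝ → ℝ → ℂ} (hψ : ContDiff ℝ (⊤ : ℕ∞) ↿ψ) (n : ℕ) (x t : ℝ) :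
    HasDerivAt (fun x' => Dx n ψ x' t) (Dx (n + 1) ψ x t) x := by
  have h : ContDiff ℝ (⊤ : ℕ∞) (fun x' => ψ x' t) :=
    hψ.comp (contDiff_id.prodMk contDiff_const)
  have hd : Differentiable ℝ (iteratedDeriv n fun x' => ψ x' t) :=
    h.differentiable_iteratedDeriv n (by exact_mod_cast WithTop.coe_lt_top n)
  simpa only [Dx, iteratedDeriv_succ] using (hd x).hasDerivAt

theorem hasDerivAt_Dx_zero {ψ : ℝ → ℝ → ℂ} (hψ : ContDiff ℝ (⊤ : ℕ∞) ↿ψ) (x t : ℝ) :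
    HasDerivAt (fun x' => ψ x' t) (Dx 1 ψ x t) x := by
  simpa only [Dx, iteratedDeriv_zero] using hasDerivAt_Dx hψ 0 x t

theorem MDt_Umat (ψ φ : ℝ → ℝ → ℂ) (lam : ℂ) (x t : ℝ) :
    MDt (fun x' t' => Umat ψ φ lam x' t') x t = !![0, I * Dt ψ x t; -I * Dt φ x t, 0] := by
  ext i j
  fin_cases i <;> fin_cases j <;> simp [MDt, Umat, Jmat, U0, Dt]

theorem MDx_V2mat {ψ φ : ℝ → ℝ → ℂ}
    (hψ : ContDiff ℝ (⊤ : ℕ∞) ↿ψ) (hφ : ContDiff ℝ (⊤ : ℕ∞) ↿φ) (lam : ℂ) (x t : ℝ) :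
    MDx (fun x' t' => V2mat ψ φ lam x' t') x t =
      (4 * lam ^ 2) • !![0, I * Dx 1 ψ x t; -I * Dx 1 φ x t, 0]
        + (2 * lam) • !![-I * (Dx 1 ψ x t * φ x t + ψ x t * Dx 1 φ x t), -Dx 2 ψ x t;
            -Dx 2 φ x t, I * (Dx 1 ψ x t * φ x t + ψ x t * Dx 1 φ x t)]
        + !![Dx 2 ψ x t * φ x t - Dx 2 φ x t * ψ x t,
            2 * I * (2 * ψ x t * Dx 1 ψ x t * φ x t + ψ x t ^ 2 * Dx 1 φ x t) - I * Dx 3 ψ x t;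
            -2 * I * (2 * φ x t * Dx 1 φ x t * ψ x t + φ x t ^ 2 * Dx 1 ψ x t) + I * Dx 3 φ x t,
            Dx 2 φ x t * ψ x t - Dx 2 ψ x t * φ x t] := by
  have p0 := hasDerivAt_Dx_zero hψ x t
  have p1 := hasDerivAt_Dx hψ 1 x t
  have p2 := hasDerivAt_Dx hψ 2 x t
  have q0 := hasDerivAt_Dx_zero hφ x t
  have q1 := hasDerivAt_Dx hφ 1 x t
  have q2 := hasDerivAt_Dx hφ 2 x t
  have hU12 := p0.const_mul I
  have hU21 := q0.const_mul (-I)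
  have hV11 := (p0.const_mul (-I)).mul q0
  have hV22 := (p0.const_mul I).mul q0
  have hW11 := (p1.mul q0).sub (q1.mul p0)
  have hW12 := (((p0.pow 2).const_mul (2 * I)).mul q0).sub (p2.const_mul I)
  have hW21 := (((q0.pow 2).const_mul (-2 * I)).mul p0).add (q2.const_mul I)
  have hW22 := (q1.mul p0).sub (p1.mul q0)
  have h0 (c : ℂ) := hasDerivAt_const x (4 * lam ^ 3 * c)
  have hz := hasDerivAt_const x (4 * lam ^ 2 * 0)
  have e11 := (((h0 (-I)).add hz).add (hV11.const_mul (2 * lam))).add hW11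
  have e12 := (((h0 0).add (hU12.const_mul (4 * lam ^ 2))).add (p1.neg.const_mul (2 * lam))).add hW12
  have e21 := (((h0 0).add (hU21.const_mul (4 * lam ^ 2))).add (q1.neg.const_mul (2 * lam))).add hW21
  have e22 := (((h0 I).add hz).add (hV22.const_mul (2 * lam))).add hW22
  ext i j
  fin_cases i <;> fin_cases j
  · refine e11.deriv.trans ?_
    simp
    ring
  · refine e12.deriv.trans ?_
    simp
    ring
  · refine e21.deriv.trans ?_
    simp
    ring
  · refine e22.deriv.trans ?_
    simp
    ring

/-- The zero-curvature expression does not depend on `λ`, and its entries are, up to a factor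
`± i`, the left-hand sides of the coupled mKdV system. -/
theorem zero_curvature_eq {ψ φ : ℝ → ℝ → ℂ}
    (hψ : ContDiff ℝ (⊤ : ℕ∞) ↿ψ) (hφ : ContDiff ℝ (⊤ : ℕ∞) ↿φ) (lam : ℂ) (x t : ℝ) :
    MDt (fun x' t' => Umat ψ φ lam x' t') x t
        - MDx (fun x' t' => V2mat ψ φ lam x' t') x t
        + (Umat ψ φ lam x t * V2mat ψ φ lam x t - V2mat ψ φ lam x t * Umat ψ φ lam x t) =
      !![0, I * (Dt ψ x t + Dx 3 ψ x t - 6 * ψ x t * φ x t * Dx 1 ψ x t);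
        -I * (Dt φ x t + Dx 3 φ x t - 6 * ψ x t * φ x t * Dx 1 φ x t), 0] := by
  rw [MDt_Umat, MDx_V2mat hψ hφ]
  ext i j
  fin_cases i <;> fin_cases j <;>
    simp [Umat, V2mat, Jmat, U0, V10, V20] <;>
    grind [I_mul_I]

/-- The zero-curvature equation `U_t − (V₂)_x + [U, V₂] = 0` (for all `λ`) is
equivalent to the coupled mKdV system, the second member of the AKNS hierarchy. -/
theorem zero_curvature_iff_coupled_mkdv (ψ φ : ℝ → ℝ → ℂ)
    (hψ : ContDiff ℝ (⊤ : ℕ∞) ↿ψ) (hφ : ContDiff ℝ (⊤ : ℕ∞) ↿φ) :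
    (∀ (lam : ℂ) (x t : ℝ),
      MDt (fun x' t' => Umat ψ φ lam x' t') x t
        - MDx (fun x' t' => V2mat ψ φ lam x' t') x t
        + (Umat ψ φ lam x t * V2mat ψ φ lam x t
            - V2mat ψ φ lam x t * Umat ψ φ lam x t) = 0) ↔
    (∀ x t : ℝ,
      Dt ψ x t + Dx 3 ψ x t - 6 * ψ x t * φ x t * Dx 1 ψ x t = 0 ∧
      Dt φ x t + Dx 3 φ x t - 6 * ψ x t * φ x t * Dx 1 φ x t = 0) := by
  simp only [zero_curvature_eq hψ hφ, forall_const]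
  refine forall₂_congr fun x t => ?_
  simp [← Matrix.ext_iff, Fin.forall_fin_two]
end
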